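/- Let F be a number field with ring of integers O_F, let d ≥ 2 be an integer, and let c ∈ O_F. Let p ∈ ℤ be prime, let 𝔭 ⊂ O_F be a prime ideal lying above p, and let k_𝔭 := O_F/𝔭. Suppose P ∈ O_F has exact period N under f_{d,c}, and suppose the reduction P̃ ∈ k_𝔭 of P has exact period N' under the reduced map z ↦ z^d + c̃ over k_𝔭. Then either N = N', or the derivative (f̃^{N'})'(P̃) = d^{N'}·Π_{k=0}^{N'-1} (f̃^k(P̃))^{d-1} is nonzero in k_𝔭 and N = N'·r·p^e for some integer e ≥ 0, where r is the multiplicative order of (f̃^{N'})'(P̃) in k_𝔭^×. In particular, if (f̃^{N'})'(P̃) = 0, then N = N'. -/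

import Mathlib

open Function Finset

/-- `x` is periodic of exact period `N ≥ 1` under `φ`: `φ^[N] x = x` and `N` is minimal. -/
def ExactPeriod {R : Type*} (φ : R → R) (x : R) (N : ℕ) : Prop :=
  0 < N ∧ φ^[N] x = x ∧ ∀ n : ℕ, 0 < n → φ^[n] x = x → N ≤ n

def MSGood {R k : Type*} [CommRing R] [CommRing k] (π : R →+* k) (φ : R → R) (a b l : k) : Prop :=
  ∀ y z, π y = a → π z = a → π (φ y) = b ∧ ∃ μ, π μ = l ∧ φ y - φ z = μ * (y - z)

theorem MSGood.comp {R k : Type*} [CommRing R] [CommRing k] {π : R →+* k} {φ ψ : R → R}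
    {a b b' l m : k} (h1 : MSGood π φ a b l) (h2 : MSGood π ψ b b' m) :
    MSGood π (ψ ∘ φ) a b' (m * l) := by
  intro y z hy hz
  obtain ⟨hb, μ, hμ, e⟩ := h1 y z hy hz
  obtain ⟨hb', ν, hν, e'⟩ := h2 (φ y) (φ z) hb (h1 z z hz hz).1
  refine ⟨hb', ν * μ, by rw [map_mul, hμ, hν], ?_⟩
  simp only [comp_apply]
  rw [e', e, mul_assoc]

theorem MSGood.iter {R k : Type*} [CommRing R] [CommRing k] {π : R →+* k} {φ : R → R}
    {a l : k} (h : MSGood π φ a a l) (n : ℕ) : MSGood π (φ^[n]) a a (l ^ n) := by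
  induction n with
  | zero => exact fun y z hy _ => ⟨hy, 1, by simp, by simp⟩
  | succ n ih =>
    rw [iterate_succ', pow_succ']
    exact ih.comp h

theorem MSGood.base {R k : Type*} [CommRing R] [CommRing k] (π : R →+* k) (d : ℕ) (c : R)
    (a : k) : MSGood π (fun z => z ^ d + c) a (a ^ d + π c) (d * a ^ (d - 1)) := by
  intro y z hy hz
  refine ⟨by simp [hy], ∑ i ∈ Finset.range d, y ^ i * z ^ (d - 1 - i), ?_, ?_⟩
  · simp only [map_sum, map_mul, map_pow, hy, hz]
    rw [Finset.sum_congr rfl (g := fun _ => a ^ (d - 1))]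
    · simp
    · intro i hi
      have := Finset.mem_range.1 hi
      rw [← pow_add]
      congr 1
      omega
  · rw [geom_sum₂_mul]
    ring

theorem MSGood.base_iter {R k : Type*} [CommRing R] [CommRing k] (π : R →+* k) (d : ℕ) (c : R)
    (a : k) (n : ℕ) : MSGood π ((fun z => z ^ d + c)^[n]) a ((fun z => z ^ d + π c)^[n] a)
      ((d : k) ^ n * ∏ i ∈ Finset.range n, ((fun z => z ^ d + π c)^[i] a) ^ (d - 1)) := by
  induction n with
  | zero => exact fun y z hy _ => ⟨hy, 1, by simp, by simp⟩
  | succ n ih =>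
    have := ih.comp (MSGood.base π d c _)
    rw [← iterate_succ' (fun z => z ^ d + c)] at this
    rw [iterate_succ_apply' (fun z => z ^ d + π c)]
    convert this using 1
    rw [Finset.prod_range_succ]
    ring

theorem MSGood.geom {R k : Type*} [CommRing R] [IsDomain R] [CommRing k] {π : R →+* k}
    {φ : R → R} {a l : k} (h : MSGood π φ a a l) {P : R} (hP : π P = a) (hne : φ P ≠ P)
    {M : ℕ} (hM : φ^[M] P = P) : ∑ i ∈ Finset.range M, l ^ i = 0 := by
  have key : ∀ n, ∃ s, π s = ∑ i ∈ Finset.range n, l ^ i ∧ φ^[n] P - P = s * (φ P - P) := by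
    intro n
    induction n with
    | zero => exact ⟨0, by simp, by simp⟩
    | succ n ih =>
      obtain ⟨s, hs, e⟩ := ih
      obtain ⟨-, μ, hμ, e'⟩ := h (φ^[n] P) P (h.iter n P P hP hP).1 hP
      refine ⟨μ * s + 1, by rw [geom_sum_succ, map_add, map_mul, hμ, hs, map_one], ?_⟩
      rw [iterate_succ_apply']
      rw [e] at e'
      linear_combination e'
  obtain ⟨s, hs, e⟩ := key M
  rw [hM, sub_self] at e
  have : s = 0 := by
    rcases mul_eq_zero.1 e.symm with h | h
    · exact h
    · exact absurd (sub_eq_zero.1 h) hne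
  rw [← hs, this, map_zero]

theorem MSGood.minPer_one {R k : Type*} [CommRing R] [IsDomain R] [CommRing k]
    {π : R →+* k} {a : k} {P : R} (hP : π P = a) (p : ℕ) (hp : p.Prime) [CharP k p] (M : ℕ) :
    ∀ φ : R → R, MSGood π φ a a 1 → 0 < M → minimalPeriod φ P = M → ∃ e : ℕ, M = p ^ e := by
  induction M using Nat.strong_induction_on with
  | _ M ih =>
    intro φ h hM hm
    by_cases hf : φ P = P
    · refine ⟨0, ?_⟩
      rw [← hm, pow_zero]
      exact minimalPeriod_eq_one_iff_isFixedPt.2 hf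
    · have hs := h.geom hP hf (M := M) (by rw [← hm]; exact iterate_minimalPeriod)
      simp only [one_pow, sum_const, card_range, nsmul_eq_mul, mul_one] at hs
      obtain ⟨q, rfl⟩ := (CharP.cast_eq_zero_iff k p M).1 hs
      have hq : 0 < q := Nat.pos_of_mul_pos_left hM
      have := minimalPeriod_iterate_eq_div_gcd (f := φ) (x := P) hp.ne_zero
      rw [hm, Nat.gcd_mul_right_left, Nat.mul_div_cancel_left _ hp.pos] at this
      obtain ⟨e, he⟩ := ih q (by nlinarith [hp.two_le]) (φ^[p]) (by simpa using h.iter p) hq this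
      exact ⟨e + 1, by rw [pow_succ', ← he]⟩

theorem ExactPeriod.eq_minPer {R : Type*} {φ : R → R} {x : R} {N : ℕ} (h : ExactPeriod φ x N) :
    minimalPeriod φ x = N := by
  obtain ⟨h0, h1, h2⟩ := h
  apply le_antisymm
  · exact IsPeriodicPt.minimalPeriod_le h0 h1
  · exact h2 _ (IsPeriodicPt.minimalPeriod_pos h0 h1) iterate_minimalPeriod

theorem MSGood.main {R k : Type*} [CommRing R] [IsDomain R] [CommRing k] [Nontrivial k]
    (π : R →+* k) (d : ℕ) (c P : R) (p : ℕ) (hp : p.Prime) (hpk : (p : k) = 0) (N N' : ℕ)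
    (hN : ExactPeriod (fun z => z ^ d + c) P N)
    (hN' : ExactPeriod (fun z => z ^ d + π c) (π P) N') (δ : k)
    (hδ : δ = (d : k) ^ N' *
      ∏ i ∈ Finset.range N', ((fun z => z ^ d + π c)^[i] (π P)) ^ (d - 1)) :
    N = N' ∨ (δ ≠ 0 ∧ ∃ e : ℕ, N = N' * orderOf δ * p ^ e) := by
  haveI : CharP k p := by
    haveI := Fact.mk hp
    exact (CharP.charP_iff_prime_eq_zero hp).2 hpk
  have hg := MSGood.base_iter π d c (π P) N'
  rw [hN'.2.1, ← hδ] at hg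
  have hdvd : N' ∣ N := by
    rw [← hN'.eq_minPer]
    apply IsPeriodicPt.minimalPeriod_dvd
    have := (MSGood.base_iter π d c (π P) N P P rfl rfl).1
    rw [hN.2.1] at this
    exact this.symm
  obtain ⟨M, rfl⟩ := hdvd
  have hM : 0 < M := Nat.pos_of_mul_pos_left hN.1
  set g := (fun z : R => z ^ d + c)^[N'] with hgdef
  have hmp : minimalPeriod g P = M := by
    rw [hgdef, minimalPeriod_iterate_eq_div_gcd hN'.1.ne', hN.eq_minPer,
      Nat.gcd_mul_right_left, Nat.mul_div_cancel_left _ hN'.1]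
  by_cases hf : g P = P
  · left
    rw [← hmp, minimalPeriod_eq_one_iff_isFixedPt.2 hf, mul_one]
  · right
    have hs := hg.geom rfl hf (M := M) (by rw [← hmp]; exact iterate_minimalPeriod)
    have h1 : δ ^ M = 1 := by
      have := geom_sum_mul δ M
      rw [hs, zero_mul] at this
      exact (sub_eq_zero.1 this.symm)
    refine ⟨?_, ?_⟩
    · rintro h0
      rw [h0, zero_pow hM.ne'] at h1
      exact zero_ne_one h1
    · obtain ⟨q, hq⟩ := orderOf_dvd_of_pow_eq_one h1
      have hr : 0 < orderOf δ := Nat.pos_of_mul_pos_right (hq ▸ hM)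
      have hq0 : 0 < q := Nat.pos_of_mul_pos_left (hq ▸ hM)
      have hi := hg.iter (orderOf δ)
      rw [pow_orderOf_eq_one] at hi
      obtain ⟨e, he⟩ := MSGood.minPer_one rfl p hp q _ hi hq0 (by
        rw [minimalPeriod_iterate_eq_div_gcd hr.ne', hmp, hq,
          Nat.gcd_mul_right_left, Nat.mul_div_cancel_left _ hr])
      exact ⟨e, by rw [hq, he, mul_assoc]⟩

set_option synthInstance.maxHeartbeats 1000000 in
/-- Morton–Silverman: if `P ∈ O_F` has exact period `N` under `f_{d,c}(z) = z^d + c` and its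
reduction mod a prime `𝔭` above `p` has exact period `N'`, then `N = N'`, or the multiplier
`(f̃^{N'})'(P̃) = d^{N'} ∏_{k<N'} (f̃^k(P̃))^{d-1}` is nonzero and `N = N' r p^e` where `r` is
its multiplicative order. In particular, if the multiplier vanishes, `N = N'`. -/
theorem morton_silverman (F : Type*) [Field F] [NumberField F] (d : ℕ) (hd : 2 ≤ d)
    (c P : NumberField.RingOfIntegers F) (p : ℕ) (hp : p.Prime)
    (𝔭 : Ideal (NumberField.RingOfIntegers F)) (h𝔭 : 𝔭.IsPrime)
    (hlie : (p : NumberField.RingOfIntegers F) ∈ 𝔭)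
    (N N' : ℕ)
    (hN : ExactPeriod (fun z => z ^ d + c) P N)
    (hN' : ExactPeriod (fun z => z ^ d + Ideal.Quotient.mk 𝔭 c) (Ideal.Quotient.mk 𝔭 P) N')
    (δ : NumberField.RingOfIntegers F ⧸ 𝔭)
    (hδ : δ = (d : NumberField.RingOfIntegers F ⧸ 𝔭) ^ N' *
      ∏ k ∈ Finset.range N',
        ((fun z => z ^ d + Ideal.Quotient.mk 𝔭 c)^[k] (Ideal.Quotient.mk 𝔭 P)) ^ (d - 1)) :
    (N = N' ∨ (δ ≠ 0 ∧ ∃ e : ℕ, N = N' * orderOf δ * p ^ e)) ∧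
    (δ = 0 → N = N') := by
  have := Ideal.Quotient.nontrivial_iff.2 h𝔭.ne_top
  have h := MSGood.main (Ideal.Quotient.mk 𝔭) d c P p hp
    (by rw [← map_natCast (Ideal.Quotient.mk 𝔭)]; exact Ideal.Quotient.eq_zero_iff_mem.2 hlie)
    N N' hN hN' δ hδ
  exact ⟨h, fun h0 => h.resolve_right fun h' => h'.1 h0⟩
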